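/- Let X be an n-dimensional centered Gaussian vector (n > 1) arranged as the value X, gradient ∇X, and Hessian ∇²X of a stationary, unit-variance, C², isotropic-in-law Gaussian field at a point, with nondegenerate joint distribution. Then E[det(∇²X) · X] = 0. -/

import Mathlib

open MeasureTheory

namespace GH
set_option linter.unusedSectionVars false
open ProbabilityTheory Filter Topology

lemma integrable_poly (v : NNReal) (p : Polynomial ℝ) :
    Integrable (fun x => p.eval x) (gaussianReal 0 v) := by
  induction p using Polynomial.induction_on' with
  | add p q hp hq =>
    simp only [Polynomial.eval_add]
    exact hp.add hq
  | monomial n a =>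
    simp only [Polynomial.eval_monomial]
    apply Integrable.const_mul
    have h := (memLp_id_gaussianReal (μ := 0) (v := v) (n : NNReal))
    by_cases hn : n = 0
    · subst hn; simp
    have := h.integrable_norm_rpow' 
    simp only [ENNReal.coe_natCast, ENNReal.toReal_natCast, Real.rpow_natCast, id] at this
    rw [← integrable_norm_iff (by fun_prop)]
    simpa using this

lemma stein_poly (v : NNReal) (p : Polynomial ℝ) :
    ∫ x, x * p.eval x ∂(gaussianReal 0 v) =
      v * ∫ x, p.derivative.eval x ∂(gaussianReal 0 v) := by
  by_cases hv : v = 0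
  · subst hv; simp [gaussianReal_zero_var]
  have hv' : (v : ℝ) ≠ 0 := by exact_mod_cast hv
  have hi : ∀ q : Polynomial ℝ, Integrable (fun x => q.eval x * gaussianPDFReal 0 v x) := by
    intro q
    have := integrable_poly v q
    rw [gaussianReal_of_var_ne_zero _ hv, integrable_withDensity_iff_integrable_smul'
      (measurable_gaussianPDF 0 v) (ae_of_all _ fun x => gaussianPDF_lt_top)] at this
    simpa [toReal_gaussianPDF, mul_comm] using this
  rw [integral_gaussianReal_eq_integral_smul hv, integral_gaussianReal_eq_integral_smul hv]
  have hd : ∀ x, HasDerivAt (gaussianPDFReal 0 v) (-(x / v) * gaussianPDFReal 0 v x) x := by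
    intro x
    have h1 : HasDerivAt (fun y : ℝ => -(y - 0) ^ 2 / (2 * v)) (-(x / v)) x := by
      have := (((hasDerivAt_id x).sub_const 0).pow 2).neg.div_const (2 * (v : ℝ))
      refine HasDerivAt.congr_deriv this ?_
      simp [id]; field_simp
    have := (h1.exp).const_mul (√(2 * Real.pi * v))⁻¹
    refine HasDerivAt.congr_deriv this ?_
    simp only [gaussianPDFReal]; ring
  have := integral_mul_deriv_eq_deriv_mul_of_integrable (u := fun x => p.eval x)
    (u' := fun x => p.derivative.eval x) (v := gaussianPDFReal 0 v)
    (v' := fun x => -(x / v) * gaussianPDFReal 0 v x)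
    (fun x _ => p.hasDerivAt x) (fun x _ => hd x)
    (by
      have := (hi (Polynomial.X * p)).const_mul (-(v : ℝ)⁻¹)
      refine this.congr (ae_of_all _ fun x => ?_)
      simp; ring)
    (hi p.derivative) (hi p)
  have e1 : ∫ x, gaussianPDFReal 0 v x • (x * p.eval x) =
      -v * ∫ x, p.eval x * (-(x / v) * gaussianPDFReal 0 v x) := by
    rw [← integral_const_mul]
    congr 1; ext x; simp; field_simp
  rw [e1, this]
  simp [mul_comm]

variable {Ω : Type*} [MeasurableSpace Ω] {μ : Measure Ω} [IsProbabilityMeasure μ]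

/-- A linear space of random variables all of which are centered Gaussian. -/
def IsCG (μ : Measure Ω) (V : Submodule ℝ (Ω → ℝ)) : Prop :=
  ∀ Z ∈ V, ∃ v : NNReal, μ.map Z = gaussianReal 0 v

variable {V : Submodule ℝ (Ω → ℝ)}

lemma IsCG.law (h : IsCG μ V) {Z : Ω → ℝ} (hZ : Z ∈ V) : HasGaussianLaw Z μ := by
  obtain ⟨v, hv⟩ := h Z hZ
  exact ⟨by rw [hv]; infer_instance⟩

lemma IsCG.mean (h : IsCG μ V) {Z : Ω → ℝ} (hZ : Z ∈ V) : ∫ ω, Z ω ∂μ = 0 := by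
  obtain ⟨v, hv⟩ := h Z hZ
  have := integral_map (h.law hZ).aemeasurable (f := fun x : ℝ => x) (by fun_prop)
  rw [← this, hv, integral_id_gaussianReal]

lemma sq_of_law {Z : Ω → ℝ} {v : NNReal} (hv : μ.map Z = gaussianReal 0 v) :
    ∫ ω, Z ω * Z ω ∂μ = v := by
  have hm : AEMeasurable Z μ := AEMeasurable.of_map_ne_zero (by
    rw [hv]; exact IsProbabilityMeasure.ne_zero _)
  have := integral_map hm (f := fun x : ℝ => x * x) (by fun_prop)
  rw [← this, hv]
  have := stein_poly v Polynomial.X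
  simpa using this

lemma IsCG.pi (h : IsCG μ V) {ι : Type*} [Fintype ι] {Y : ι → Ω → ℝ} (hY : ∀ i, Y i ∈ V) :
    HasGaussianLaw (fun ω i => Y i ω) μ := by
  classical
  have hm : AEMeasurable (fun ω i => Y i ω) μ :=
    aemeasurable_pi_lambda _ fun i => (h.law (hY i)).aemeasurable
  refine ⟨isGaussian_of_map_eq_gaussianReal fun L => ?_⟩
  obtain ⟨v, hv⟩ := h (∑ i, L (Pi.single i 1) • Y i)
    (Submodule.sum_mem _ fun i _ => Submodule.smul_mem _ _ (hY i))
  refine ⟨0, v, ?_⟩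
  rw [AEMeasurable.map_map_of_aemeasurable (by fun_prop) hm, ← hv]
  congr 1
  ext ω
  simp only [Function.comp, Finset.sum_apply, Pi.smul_apply, smul_eq_mul]
  conv_lhs => rw [← Finset.univ_sum_single (fun i => Y i ω)]
  rw [map_sum]
  refine Finset.sum_congr rfl fun i _ => ?_
  have : (Pi.single i (Y i ω) : ι → ℝ) = Y i ω • Pi.single i 1 := by
    ext j; by_cases hj : j = i
    · subst hj; simp
    · simp [hj]
  rw [this, map_smul]; simp [mul_comm]

lemma IsCG.memLp_prod (h : IsCG μ V) {ι : Type*} {Y : ι → Ω → ℝ} (s : Finset ι)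
    (hY : ∀ i ∈ s, Y i ∈ V) : ∀ p : ENNReal, p ≠ ⊤ → MemLp (fun ω => ∏ i ∈ s, Y i ω) p μ := by
  classical
  induction s using Finset.induction_on with
  | empty => intro p _; simpa using memLp_const (1 : ℝ)
  | insert a s ha ih =>
    intro p hp
    simp only [Finset.prod_insert ha]
    have h2 : (2 * p : ENNReal) ≠ ⊤ := ENNReal.mul_ne_top (by simp) hp
    have : ENNReal.HolderTriple (2 * p) (2 * p) p := ⟨by
      rw [ENNReal.mul_inv (by simp) (by simp), ← add_mul, ENNReal.inv_two_add_inv_two, one_mul]⟩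
    exact (ih (fun i hi => hY i (by simp [hi])) _ h2).mul'
      ((h.law (hY a (by simp))).memLp h2)

lemma IsCG.integrable_mul_prod (h : IsCG μ V) {ι : Type*} {Z : Ω → ℝ} (hZ : Z ∈ V)
    {Y : ι → Ω → ℝ} (s : Finset ι) (hY : ∀ i, Y i ∈ V) :
    Integrable (fun ω => Z ω * ∏ i ∈ s, Y i ω) μ := by
  have := (h.memLp_prod s (fun i _ => hY i) 2 (by simp)).mul' (r := 1) ((h.law hZ).memLp_two)
  exact memLp_one_iff_integrable.1 this

lemma IsCG.integrable_prod (h : IsCG μ V) {ι : Type*}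
    {Y : ι → Ω → ℝ} (s : Finset ι) (hY : ∀ i, Y i ∈ V) :
    Integrable (fun ω => ∏ i ∈ s, Y i ω) μ :=
  memLp_one_iff_integrable.1 (h.memLp_prod s (fun i _ => hY i) 1 (by simp))

lemma IsCG.integrable_mul (h : IsCG μ V) {Z W : Ω → ℝ} (hZ : Z ∈ V) (hW : W ∈ V) :
    Integrable (fun ω => Z ω * W ω) μ :=
  memLp_one_iff_integrable.1 ((h.law hW).memLp_two.mul' (r := 1) ((h.law hZ).memLp_two))

/-- Wick / Isserlis recursion. -/
lemma IsCG.wick (h : IsCG μ V) {ι : Type*} [Fintype ι] [DecidableEq ι] {Z : Ω → ℝ} (hZ : Z ∈ V)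
    {Y : ι → Ω → ℝ} (s : Finset ι) (hY : ∀ i, Y i ∈ V) :
    ∫ ω, Z ω * ∏ i ∈ s, Y i ω ∂μ =
      ∑ j ∈ s, (∫ ω, Z ω * Y j ω ∂μ) * ∫ ω, ∏ i ∈ s.erase j, Y i ω ∂μ := by
  obtain ⟨v, hv⟩ := h Z hZ
  have hvar := sq_of_law hv
  have hZm := (h.law hZ).aemeasurable
  by_cases hv0 : v = 0
  · have hZ0 : ∀ᵐ ω ∂μ, Z ω = 0 := by
      subst hv0
      rw [gaussianReal_zero_var] at hv
      have : ∀ᵐ x ∂(μ.map Z), x = 0 := by rw [hv]; simp [ae_dirac_eq]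
      exact ae_of_ae_map hZm this
    have e : ∀ f : Ω → ℝ, ∫ ω, Z ω * f ω ∂μ = 0 := fun f => by
      apply integral_eq_zero_of_ae
      filter_upwards [hZ0] with ω hω
      simp [hω]
    simp [e]
  have hv' : (v : ℝ) ≠ 0 := by exact_mod_cast hv0
  set b : ι → ℝ := fun i => (∫ ω, Z ω * Y i ω ∂μ) / v with hb
  set W : ι → Ω → ℝ := fun i => Y i - b i • Z with hW
  have hWV : ∀ i, W i ∈ V := fun i => V.sub_mem (hY i) (V.smul_mem _ hZ)
  have hYW : ∀ i ω, Y i ω = b i * Z ω + W i ω := fun i ω => by simp [hW]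
  have hcov : ∀ i, ∫ ω, Z ω * W i ω ∂μ = 0 := by
    intro i
    have : ∀ ω, Z ω * W i ω = Z ω * Y i ω - b i * (Z ω * Z ω) := fun ω => by
      simp [hW]; ring
    simp_rw [this]
    rw [integral_sub (h.integrable_mul hZ (hY i)) ((h.integrable_mul hZ hZ).const_mul _),
      integral_const_mul, hvar]
    simp [hb]; field_simp; simp
  have hind : IndepFun Z (fun ω i => W i ω) μ := by
    have hp : HasGaussianLaw (fun ω => ((fun _ : Unit => Z ω), fun j => W j ω)) μ := by
      have := h.pi (Y := fun o : Option ι => o.elim Z W) (fun o => by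
        cases o
        · exact hZ
        · exact hWV _)
      let L : (Option ι → ℝ) →L[ℝ] ((Unit → ℝ) × (ι → ℝ)) :=
        (ContinuousLinearMap.pi fun _ => ContinuousLinearMap.proj none).prod
          (ContinuousLinearMap.pi fun i => ContinuousLinearMap.proj (some i))
      exact this.map L
    have := hp.indepFun_of_covariance_eval (X := fun _ : Unit => Z) (Y := W) (fun _ j => by
      rw [covariance_eq_sub (h.law hZ).memLp_two (h.law (hWV j)).memLp_two]
      have := h.mean hZ
      have h2 := hcov j
      simp [this, h2])
    exact this.comp (φ := fun f : Unit → ℝ => f ()) (ψ := id) (by fun_prop) (by fun_prop)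
  have hWm : AEMeasurable (fun ω i => W i ω) μ :=
    aemeasurable_pi_lambda _ fun i => (h.law (hWV i)).aemeasurable
  have hprod := (indepFun_iff_map_prod_eq_prod_map_map hZm hWm).1 hind
  rw [hv] at hprod
  set ρ := μ.map (fun ω i => W i ω) with hρ
  have : IsProbabilityMeasure ρ := Measure.isProbabilityMeasure_map hWm
  have key : ∀ F : ℝ × (ι → ℝ) → ℝ, Continuous F → Integrable (fun ω => F (Z ω, fun i => W i ω)) μ →
      ∫ ω, F (Z ω, fun i => W i ω) ∂μ = ∫ w, ∫ z, F (z, w) ∂(gaussianReal 0 v) ∂ρ := by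
    intro F hF hi
    have hm : AEMeasurable (fun ω => (Z ω, fun i => W i ω)) μ := hZm.prodMk hWm
    have e := integral_map hm (f := F) hF.aestronglyMeasurable
    have hi' : Integrable F (μ.map (fun ω => (Z ω, fun i => W i ω))) :=
      (integrable_map_measure hF.aestronglyMeasurable hm).2 hi
    rw [hprod] at e hi'
    rw [← e, integral_prod_symm _ hi']
  have k1 := key (fun q => q.1 * ∏ i ∈ s, (b i * q.1 + q.2 i)) (by fun_prop)
    (by simpa only [hYW] using h.integrable_mul_prod hZ s hY)
  have hI2 : Integrable (fun ω => ∑ j ∈ s, b j * ∏ i ∈ s.erase j, Y i ω) μ :=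
    integrable_finsetSum _ fun j _ => (h.integrable_prod _ hY).const_mul _
  have k2 := key (fun q => ∑ j ∈ s, b j * ∏ i ∈ s.erase j, (b i * q.1 + q.2 i)) (by fun_prop)
    (by simpa only [hYW] using hI2)
  simp only [← hYW] at k1 k2
  rw [k1]
  have hst : ∀ w : ι → ℝ, ∫ z, z * ∏ i ∈ s, (b i * z + w i) ∂(gaussianReal 0 v) =
      v * ∫ z, ∑ j ∈ s, b j * ∏ i ∈ s.erase j, (b i * z + w i) ∂(gaussianReal 0 v) := by
    intro w
    have := stein_poly v (∏ i ∈ s, (Polynomial.C (b i) * Polynomial.X + Polynomial.C (w i)))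
    simp only [Polynomial.eval_prod, Polynomial.derivative_prod_finset, Polynomial.eval_finsetSum,
      Polynomial.eval_add, Polynomial.eval_mul, Polynomial.eval_C, Polynomial.eval_X,
      Polynomial.derivative_add, Polynomial.derivative_mul, Polynomial.derivative_C,
      Polynomial.derivative_X, zero_mul, zero_add, add_zero, mul_one] at this
    simp only [mul_comm (b _) (∏ i ∈ _, _)]
    exact this
  simp only [hst]
  rw [integral_const_mul, ← k2, integral_finsetSum _
    (fun j _ => (h.integrable_prod _ hY).const_mul _), Finset.mul_sum]
  refine Finset.sum_congr rfl fun j _ => ?_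
  rw [integral_const_mul, ← mul_assoc]
  congr 1
  simp [hb]; field_simp


/-- Pointwise sequential closure of a linear space of random variables. -/
def seqCl (V : Submodule ℝ (Ω → ℝ)) : Submodule ℝ (Ω → ℝ) where
  carrier := {Z | ∃ f : ℕ → Ω → ℝ, (∀ m, f m ∈ V) ∧
    ∀ ω, Tendsto (fun m => f m ω) atTop (𝓝 (Z ω))}
  add_mem' := by
    rintro a b ⟨f, hf, hf'⟩ ⟨g, hg, hg'⟩
    exact ⟨fun m => f m + g m, fun m => V.add_mem (hf m) (hg m), fun ω => (hf' ω).add (hg' ω)⟩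
  zero_mem' := ⟨fun _ => 0, fun _ => V.zero_mem, fun _ => tendsto_const_nhds⟩
  smul_mem' := by
    rintro c a ⟨f, hf, hf'⟩
    exact ⟨fun m => c • f m, fun m => V.smul_mem _ (hf m), fun ω => (hf' ω).const_mul c⟩

lemma le_seqCl : V ≤ seqCl V := fun Z hZ =>
  ⟨fun _ => Z, fun _ => hZ, fun _ => tendsto_const_nhds⟩

lemma IsCG.lim_law (h : IsCG μ V) {f : ℕ → Ω → ℝ} {Z : Ω → ℝ} (hf : ∀ m, f m ∈ V)
    (hfZ : ∀ ω, Tendsto (fun m => f m ω) atTop (𝓝 (Z ω))) :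
    ∃ v : NNReal, μ.map Z = gaussianReal 0 v ∧
      Tendsto (fun m => ∫ ω, f m ω * f m ω ∂μ) atTop (𝓝 v) := by
  choose v hv using fun m => h (f m) (hf m)
  have hfm : ∀ m, AEMeasurable (f m) μ := fun m => (h.law (hf m)).aemeasurable
  have hZm : AEMeasurable Z μ := aemeasurable_of_tendsto_metrizable_ae' hfm (ae_of_all _ hfZ)
  have hsq : ∀ m, ∫ ω, f m ω * f m ω ∂μ = v m := fun m => sq_of_law (hv m)
  simp only [hsq]
  have hcf : ∀ {Y : Ω → ℝ}, AEMeasurable Y μ → ∀ s : ℝ,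
      charFun (μ.map Y) s = ∫ ω, Complex.exp (s * Y ω * Complex.I) ∂μ := by
    intro Y hY s
    rw [charFun_apply_real, integral_map hY (by fun_prop)]
  have hcont : ∀ s : ℝ, Tendsto (fun m => charFun (μ.map (f m)) s) atTop
      (𝓝 (charFun (μ.map Z) s)) := by
    intro s
    simp only [hcf (hfm _), hcf hZm]
    refine tendsto_integral_of_dominated_convergence (fun _ => (1 : ℝ)) (fun m => ?_)
      (integrable_const _) (fun m => ae_of_all _ fun ω => ?_) (ae_of_all _ fun ω => ?_)
    · have := hfm m
      exact AEMeasurable.aestronglyMeasurable (by fun_prop)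
    · rw [← Complex.ofReal_mul, Complex.norm_exp_ofReal_mul_I]
    · have hc : Continuous fun x : ℝ => Complex.exp (s * x * Complex.I) := by fun_prop
      exact (hc.tendsto _).comp (hfZ ω)
  have hval : ∀ m s, charFun (μ.map (f m)) s = ((Real.exp (-(v m * s ^ 2 / 2)) : ℝ) : ℂ) := by
    intro m s
    rw [hv m, charFun_gaussianReal]
    push_cast
    congr 1; simp
  have hcreal : ∀ s : ℝ, Tendsto (fun m => Real.exp (-(v m * s ^ 2 / 2))) atTop
      (𝓝 (charFun (μ.map Z) s).re) := by
    intro s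
    have := (Complex.continuous_re.tendsto _).comp (hcont s)
    simpa only [Function.comp_def, hval, Complex.ofReal_re] using this
  have hnn : ∀ s : ℝ, 0 ≤ (charFun (μ.map Z) s).re := fun s =>
    ge_of_tendsto' (hcreal s) fun m => (Real.exp_pos _).le
  -- nonvanishing near zero
  obtain ⟨s, hs, hpos⟩ : ∃ s : ℝ, s ≠ 0 ∧ 0 < (charFun (μ.map Z) s).re := by
    have hlim : Tendsto (fun k : ℕ => charFun (μ.map Z) (1 / ((k : ℝ) + 1))) atTop (𝓝 1) := by
      simp only [hcf hZm]
      have h1 : (1 : ℂ) = ∫ _ω, (1 : ℂ) ∂μ := by simp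
      rw [h1]
      refine tendsto_integral_of_dominated_convergence (fun _ => (1 : ℝ)) (fun m => ?_)
        (integrable_const _) (fun m => ae_of_all _ fun ω => ?_) (ae_of_all _ fun ω => ?_)
      · exact AEMeasurable.aestronglyMeasurable (by fun_prop)
      · rw [← Complex.ofReal_mul, Complex.norm_exp_ofReal_mul_I]
      · have hc : Continuous fun x : ℝ => Complex.exp (x * Z ω * Complex.I) := by fun_prop
        have := (hc.tendsto 0).comp tendsto_one_div_add_atTop_nhds_zero_nat
        simpa [Function.comp_def] using this
    have hre := (Complex.continuous_re.tendsto _).comp hlim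
    have := hre.eventually (lt_mem_nhds (by simp : (0 : ℝ) < (1 : ℂ).re))
    obtain ⟨k, hk⟩ := this.exists
    exact ⟨1 / ((k : ℝ) + 1), by positivity, hk⟩
  have hvlim : Tendsto (fun m => (v m : ℝ)) atTop
      (𝓝 (-(2 / s ^ 2) * Real.log (charFun (μ.map Z) s).re)) := by
    have := (((Real.continuousAt_log hpos.ne').tendsto).comp (hcreal s)).const_mul (-(2 / s ^ 2))
    refine this.congr fun m => ?_
    simp only [Function.comp, Real.log_exp]
    field_simp
  set w := -(2 / s ^ 2) * Real.log (charFun (μ.map Z) s).re with hw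
  have hw0 : 0 ≤ w := ge_of_tendsto' hvlim fun m => (v m).2
  obtain ⟨w', hw'⟩ : ∃ w' : NNReal, (w' : ℝ) = w := ⟨⟨w, hw0⟩, rfl⟩
  rw [← hw'] at hvlim
  refine ⟨w', ?_, hvlim⟩
  have : IsProbabilityMeasure (μ.map Z) := Measure.isProbabilityMeasure_map hZm
  apply Measure.ext_of_charFun
  ext t
  have e1 := hcont t
  simp only [hval] at e1
  have e2 : Tendsto (fun m => ((Real.exp (-(v m * t ^ 2 / 2)) : ℝ) : ℂ)) atTop
      (𝓝 ((Real.exp (-(w' * t ^ 2 / 2)) : ℝ) : ℂ)) := by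
    have hc : Continuous fun x : ℝ => ((Real.exp (-(x * t ^ 2 / 2)) : ℝ) : ℂ) := by fun_prop
    exact (hc.tendsto _).comp hvlim
  rw [tendsto_nhds_unique e1 e2, charFun_gaussianReal]
  push_cast
  congr 1; simp

lemma IsCG.seqCl (h : IsCG μ V) : IsCG μ (seqCl V) := by
  rintro Z ⟨f, hf, hfZ⟩
  obtain ⟨v, hv, -⟩ := h.lim_law hf hfZ
  exact ⟨v, hv⟩

lemma IsCG.cov_tendsto (h : IsCG μ V) {f g : ℕ → Ω → ℝ} {Z W : Ω → ℝ} (hf : ∀ m, f m ∈ V)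
    (hg : ∀ m, g m ∈ V)
    (hfZ : ∀ ω, Tendsto (fun m => f m ω) atTop (𝓝 (Z ω)))
    (hgW : ∀ ω, Tendsto (fun m => g m ω) atTop (𝓝 (W ω))) :
    Tendsto (fun m => ∫ ω, f m ω * g m ω ∂μ) atTop (𝓝 (∫ ω, Z ω * W ω ∂μ)) := by
  have sq : ∀ {f : ℕ → Ω → ℝ} {Z : Ω → ℝ}, (∀ m, f m ∈ V) →
      (∀ ω, Tendsto (fun m => f m ω) atTop (𝓝 (Z ω))) →
      Tendsto (fun m => ∫ ω, f m ω * f m ω ∂μ) atTop (𝓝 (∫ ω, Z ω * Z ω ∂μ)) := by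
    intro f Z hf hfZ
    obtain ⟨v, hv, hl⟩ := h.lim_law hf hfZ
    rwa [sq_of_law hv]
  have pol : ∀ {U : Submodule ℝ (Ω → ℝ)}, IsCG μ U → ∀ {A B : Ω → ℝ}, A ∈ U → B ∈ U →
      ∫ ω, A ω * B ω ∂μ = (∫ ω, (A + B) ω * (A + B) ω ∂μ - ∫ ω, A ω * A ω ∂μ
        - ∫ ω, B ω * B ω ∂μ) / 2 := by
    intro U hU A B hA hB
    have e : ∀ ω, (A + B) ω * (A + B) ω = A ω * A ω + 2 * (A ω * B ω) + B ω * B ω := fun ω => by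
      simp; ring
    simp only [e]
    have iAA := hU.integrable_mul hA hA
    have iBB := hU.integrable_mul hB hB
    have iAB := (hU.integrable_mul hA hB).const_mul 2
    have i12 : Integrable (fun ω => A ω * A ω + 2 * (A ω * B ω)) μ := iAA.add iAB
    rw [integral_add i12 iBB, integral_add iAA iAB, integral_const_mul]
    ring
  rw [pol h.seqCl ⟨f, hf, hfZ⟩ ⟨g, hg, hgW⟩]
  simp only [fun m => pol h (hf m) (hg m)]
  have s1 := sq (f := fun m => f m + g m) (Z := Z + W) (fun m => V.add_mem (hf m) (hg m))
    (fun ω => (hfZ ω).add (hgW ω))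
  exact ((s1.sub (sq hf hfZ)).sub (sq hg hgW)).div_const 2

lemma IsCG.cov_diff (h : IsCG μ V) {A B C D : Ω → ℝ} (hA : A ∈ V) (hB : B ∈ V) (hC : C ∈ V)
    (hD : D ∈ V) (c : ℝ) :
    ∫ ω, (c • (A - B)) ω * (c • (C - D)) ω ∂μ = c ^ 2 * (∫ ω, A ω * C ω ∂μ - ∫ ω, A ω * D ω ∂μ
      - ∫ ω, B ω * C ω ∂μ + ∫ ω, B ω * D ω ∂μ) := by
  have e : ∀ ω, (c • (A - B)) ω * (c • (C - D)) ω =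
      c ^ 2 * (A ω * C ω - A ω * D ω - B ω * C ω + B ω * D ω) := fun ω => by
    simp; ring
  simp only [e]
  have i1 := h.integrable_mul hA hC
  have i2 := h.integrable_mul hA hD
  have i3 := h.integrable_mul hB hC
  have i4 := h.integrable_mul hB hD
  have i12 : Integrable (fun ω => A ω * C ω - A ω * D ω) μ := i1.sub i2
  have i123 : Integrable (fun ω => A ω * C ω - A ω * D ω - B ω * C ω) μ := i12.sub i3
  rw [integral_const_mul, integral_add i123 i4, integral_sub i12 i3,
    integral_sub i1 i2]

/-- The Gaussian cancellation. -/
lemma IsCG.det_zero (h : IsCG μ V) {n : ℕ} (hn : 1 < n) {Z : Ω → ℝ} (hZ : Z ∈ V)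
    {H : Fin n → Fin n → Ω → ℝ} (hH : ∀ i j, H i j ∈ V)
    (hsym : ∀ i j k l, ∫ ω, H i j ω * H k l ω ∂μ = ∫ ω, H i l ω * H k j ω ∂μ) :
    ∫ ω, (Matrix.of fun i j : Fin n => H i j ω).det * Z ω ∂μ = 0 := by
  have : Nontrivial (Fin n) := Fin.nontrivial_iff_two_le.2 hn
  choose k hk using fun j : Fin n => exists_ne j
  have e : ∀ ω, (Matrix.of fun i j : Fin n => H i j ω).det * Z ω =
      ∑ σ : Equiv.Perm (Fin n), ((Equiv.Perm.sign σ : ℤ) : ℝ) * (Z ω * ∏ i, H (σ i) i ω) := by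
    intro ω
    rw [Matrix.det_apply', Finset.sum_mul]
    refine Finset.sum_congr rfl fun σ _ => ?_
    simp only [Matrix.of_apply]; ring
  simp only [e]
  rw [integral_finsetSum _ (fun σ _ => (h.integrable_mul_prod hZ Finset.univ
    (fun i => hH (σ i) i)).const_mul _)]
  simp only [integral_const_mul]
  let rest : Fin n → Finset (Fin n) := fun j => (Finset.univ.erase j).erase (k j)
  have e2 : ∀ σ : Equiv.Perm (Fin n), ∫ ω, Z ω * ∏ i, H (σ i) i ω ∂μ =
      ∑ j, ∑ l ∈ rest j, (∫ ω, Z ω * H (σ j) j ω ∂μ) *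
        ((∫ ω, H (σ (k j)) (k j) ω * H (σ l) l ω ∂μ) *
          ∫ ω, ∏ i ∈ (rest j).erase l, H (σ i) i ω ∂μ) := by
    intro σ
    rw [h.wick hZ Finset.univ (fun i => hH (σ i) i)]
    refine Finset.sum_congr rfl fun j _ => ?_
    rw [← Finset.mul_sum, ← h.wick (hH (σ (k j)) (k j)) (rest j) (fun i => hH (σ i) i)]
    congr 2
    ext ω
    exact (Finset.mul_prod_erase _ (fun i => H (σ i) i ω)
      (Finset.mem_erase.2 ⟨hk j, Finset.mem_univ _⟩)).symm
  simp only [e2, Finset.mul_sum]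
  rw [Finset.sum_comm]
  refine Finset.sum_eq_zero fun j _ => ?_
  rw [Finset.sum_comm]
  refine Finset.sum_eq_zero fun l hl => ?_
  have hlk : l ≠ k j := (Finset.mem_erase.1 hl).1
  have hlj : l ≠ j := (Finset.mem_erase.1 (Finset.mem_erase.1 hl).2).1
  refine self_eq_neg.1 ?_
  rw [← Finset.sum_neg_distrib]
  refine Fintype.sum_equiv (Equiv.mulRight (Equiv.swap (k j) l)) _ _ fun σ => ?_
  have hp : ∀ ω, ∏ i ∈ (rest j).erase l, H (σ (Equiv.swap (k j) l i)) i ω =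
      ∏ i ∈ (rest j).erase l, H (σ i) i ω := by
    intro ω
    refine Finset.prod_congr rfl fun i hi => ?_
    have h1 := (Finset.mem_erase.1 hi).1
    have h2 := (Finset.mem_erase.1 (Finset.mem_erase.1 hi).2).1
    rw [Equiv.swap_apply_of_ne_of_ne h2 h1]
  simp only [Equiv.coe_mulRight, Equiv.Perm.mul_apply, hp, Equiv.swap_apply_left,
    Equiv.swap_apply_right, Equiv.swap_apply_of_ne_of_ne (hk j).symm hlj.symm,
    Equiv.Perm.sign_mul, Equiv.Perm.sign_swap hlk.symm]
  rw [hsym (σ l) (k j) (σ (k j)) l]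
  have hc : ∫ ω, H (σ l) l ω * H (σ (k j)) (k j) ω ∂μ =
      ∫ ω, H (σ (k j)) (k j) ω * H (σ l) l ω ∂μ := by simp only [mul_comm]
  rw [hc]
  simp

lemma symm_diff_tendsto {n : ℕ} {g : (Fin n → ℝ) → ℝ} {t : Fin n → ℝ}
    (hg : DifferentiableAt ℝ g t) (e : Fin n → ℝ) :
    Tendsto (fun m : ℕ => (2 * (1 / ((m : ℝ) + 1)))⁻¹ *
      (g (t + (1 / ((m : ℝ) + 1)) • e) - g (t - (1 / ((m : ℝ) + 1)) • e))) atTop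
      (𝓝 (fderiv ℝ g t e)) := by
  have h1 : HasDerivAt (fun s : ℝ => g (t + s • e)) (fderiv ℝ g t e) 0 := by
    have : HasDerivAt (fun s : ℝ => t + s • e) e 0 := by
      simpa using ((hasDerivAt_id (0 : ℝ)).smul_const e).const_add t
    have hg' : HasFDerivAt g (fderiv ℝ g t) (t + (0 : ℝ) • e) := by simpa using hg.hasFDerivAt
    exact hg'.comp_hasDerivAt 0 this
  have h2 : HasDerivAt (fun s : ℝ => g (t - s • e)) (-fderiv ℝ g t e) 0 := by
    have : HasDerivAt (fun s : ℝ => t - s • e) (-e) 0 := by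
      simpa using ((hasDerivAt_id (0 : ℝ)).smul_const e).const_sub t
    have hg' : HasFDerivAt g (fderiv ℝ g t) (t - (0 : ℝ) • e) := by simpa using hg.hasFDerivAt
    exact (hg'.comp_hasDerivAt 0 this).congr_deriv (map_neg _ _)
  have h3 := (h1.sub h2).tendsto_slope_zero
  have hseq : Tendsto (fun m : ℕ => 1 / ((m : ℝ) + 1)) atTop (𝓝[≠] 0) := by
    refine tendsto_nhdsWithin_iff.2 ⟨tendsto_one_div_add_atTop_nhds_zero_nat, ?_⟩
    exact Eventually.of_forall fun m => by
      simp only [Set.mem_compl_iff, Set.mem_singleton_iff]; positivity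
  have h4 := (h3.comp hseq).const_mul (2⁻¹ : ℝ)
  have e5 : (2⁻¹ : ℝ) * (fderiv ℝ g t e - -fderiv ℝ g t e) = fderiv ℝ g t e := by ring
  rw [e5] at h4
  refine h4.congr fun m => ?_
  simp only [Function.comp, Pi.sub_apply, zero_add, zero_smul, add_zero, sub_zero, sub_self,
    smul_eq_mul, mul_inv]
  ring

end GH

/-- For a tame (C², nondegenerate) stationary, unit-variance, isotropic-in-law centered
Gaussian field `X` on `ℝⁿ` with `n > 1`, the expectation `E[det(∇²X) · X] = 0` at any point
(here at the origin). -/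
theorem mean_det_hessian_times_field_eq_zero {n : ℕ} (hn : 1 < n)
    {Ω : Type*} [MeasurableSpace Ω] (μ : Measure Ω) [IsProbabilityMeasure μ]
    (X : (Fin n → ℝ) → Ω → ℝ)
    (hC2 : ∀ ω, ContDiff ℝ 2 fun t => X t ω)
    -- centered jointly Gaussian finite-dimensional distributions
    (hGauss : ∀ (k : ℕ) (t : Fin k → (Fin n → ℝ)) (c : Fin k → ℝ),
      ∃ v : NNReal, μ.map (fun ω => ∑ i, c i * X (t i) ω) =
        ProbabilityTheory.gaussianReal 0 v)
    -- stationarity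
    (hStat : ∀ (τ : Fin n → ℝ) (k : ℕ) (t : Fin k → (Fin n → ℝ)),
      μ.map (fun ω i => X (t i + τ) ω) = μ.map (fun ω i => X (t i) ω))
    -- unit variance
    (hVar : ∀ t, ∫ ω, (X t ω) ^ 2 ∂μ = 1)
    -- isotropy in law
    (hIso : ∀ (U : (EuclideanSpace ℝ (Fin n)) ≃ₗᵢ[ℝ] (EuclideanSpace ℝ (Fin n)))
        (k : ℕ) (t : Fin k → (Fin n → ℝ)),
      μ.map (fun ω i => X ((U (EuclideanSpace.equiv (Fin n) ℝ |>.symm (t i)) :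
          EuclideanSpace ℝ (Fin n)) : Fin n → ℝ) ω) =
        μ.map (fun ω i => X (t i) ω))
    -- nondegeneracy of (X, ∇X, ∇²X): the determinant–field product is integrable
    (hInt : Integrable (fun ω =>
      (Matrix.of fun i j : Fin n =>
        fderiv ℝ (fun t => fderiv ℝ (fun u => X u ω) t (Pi.single j 1)) 0
          (Pi.single i 1)).det * X 0 ω) μ) :
    ∫ ω, (Matrix.of fun i j : Fin n =>
        fderiv ℝ (fun t => fderiv ℝ (fun u => X u ω) t (Pi.single j 1)) 0
          (Pi.single i 1)).det * X 0 ω ∂μ = 0 := by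
  classical
  let e : Fin n → (Fin n → ℝ) := fun j => Pi.single j 1
  let V : Submodule ℝ (Ω → ℝ) := Submodule.span ℝ (Set.range X)
  have hV : GH.IsCG μ V := by
    intro Z hZ
    obtain ⟨k, c, g, rfl⟩ := Submodule.mem_span_set'.1 hZ
    choose t ht using fun i => (g i).2
    obtain ⟨v, hv⟩ := hGauss k t c
    refine ⟨v, ?_⟩
    rw [← hv]
    congr 1
    ext ω
    simp [ht]
  have hXV : ∀ t, X t ∈ V := fun t => Submodule.subset_span ⟨t, rfl⟩
  have hXm : ∀ t, AEMeasurable (X t) μ := fun t => (hV.law (hXV t)).aemeasurable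
  -- stationarity of the covariance
  have hr : ∀ s t τ, ∫ ω, X (s + τ) ω * X (t + τ) ω ∂μ = ∫ ω, X s ω * X t ω ∂μ := by
    intro s t τ
    have h := hStat τ 2 ![s, t]
    have h2 := congrArg (fun ν : Measure (Fin 2 → ℝ) => ∫ x, x 0 * x 1 ∂ν) h
    beta_reduce at h2
    rw [integral_map (aemeasurable_pi_lambda _ fun i => hXm _)
        (Continuous.aestronglyMeasurable (by fun_prop)),
      integral_map (aemeasurable_pi_lambda _ fun i => hXm _)
        (Continuous.aestronglyMeasurable (by fun_prop))] at h2
    simpa using h2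
  let A : (Fin n → ℝ) → Fin n → Ω → ℝ := fun t j ω => fderiv ℝ (fun u => X u ω) t (e j)
  let h : ℕ → ℝ := fun m => 1 / ((m : ℝ) + 1)
  let D : ℕ → (Fin n → ℝ) → Fin n → Ω → ℝ := fun m t j =>
    (2 * h m)⁻¹ • (X (t + h m • e j) - X (t - h m • e j))
  have hDV : ∀ m t j, D m t j ∈ V := fun m t j =>
    V.smul_mem _ (V.sub_mem (hXV _) (hXV _))
  have hDA : ∀ t j ω, Filter.Tendsto (fun m => D m t j ω) Filter.atTop (nhds (A t j ω)) := by
    intro t j ω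
    exact GH.symm_diff_tendsto (((hC2 ω).differentiable (by norm_num)) t) (e j)
  have hAV : ∀ t j, A t j ∈ GH.seqCl V := fun t j =>
    ⟨fun m => D m t j, fun m => hDV m t j, hDA t j⟩
  have hAsym : ∀ s t j l, ∫ ω, A s j ω * A t l ω ∂μ = ∫ ω, A s l ω * A t j ω ∂μ := by
    intro s t j l
    refine tendsto_nhds_unique
      (hV.cov_tendsto (fun m => hDV m s j) (fun m => hDV m t l) (hDA s j) (hDA t l)) ?_
    refine (hV.cov_tendsto (fun m => hDV m s l) (fun m => hDV m t j) (hDA s l) (hDA t j)).congr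
      fun m => ?_
    simp only [D]
    rw [hV.cov_diff (hXV _) (hXV _) (hXV _) (hXV _), hV.cov_diff (hXV _) (hXV _) (hXV _) (hXV _)]
    set a := h m • e j
    set b := h m • e l
    have r1 := hr (s + b) (t + a) (-a - b)
    have r2 := hr (s + b) (t - a) (a - b)
    have r3 := hr (s - b) (t + a) (b - a)
    have r4 := hr (s - b) (t - a) (a + b)
    rw [show s + b + (-a - b) = s - a by abel, show t + a + (-a - b) = t - b by abel] at r1
    rw [show s + b + (a - b) = s + a by abel, show t - a + (a - b) = t - b by abel] at r2
    rw [show s - b + (b - a) = s - a by abel, show t + a + (b - a) = t + b by abel] at r3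
    rw [show s - b + (a + b) = s + a by abel, show t - a + (a + b) = t + b by abel] at r4
    rw [← r1, ← r2, ← r3, ← r4]
    ring
  have hV1 := hV.seqCl
  let D2 : ℕ → Fin n → Fin n → Ω → ℝ := fun m i j =>
    (2 * h m)⁻¹ • (A (0 + h m • e i) j - A (0 - h m • e i) j)
  let H : Fin n → Fin n → Ω → ℝ := fun i j ω =>
    fderiv ℝ (fun t => fderiv ℝ (fun u => X u ω) t (e j)) 0 (e i)
  have hD2V : ∀ m i j, D2 m i j ∈ GH.seqCl V := fun m i j =>
    (GH.seqCl V).smul_mem _ ((GH.seqCl V).sub_mem (hAV _ _) (hAV _ _))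
  have hD2H : ∀ i j ω, Filter.Tendsto (fun m => D2 m i j ω) Filter.atTop (nhds (H i j ω)) := by
    intro i j ω
    have hd : Differentiable ℝ (fun t => fderiv ℝ (fun u => X u ω) t (e j)) := by
      have h1 : ContDiff ℝ 1 (fderiv ℝ (fun u => X u ω)) :=
        (hC2 ω).fderiv_right (by norm_num)
      exact (h1.differentiable (by norm_num)).clm_apply (differentiable_const _)
    exact GH.symm_diff_tendsto (hd 0) (e i)
  have hHV : ∀ i j, H i j ∈ GH.seqCl (GH.seqCl V) := fun i j =>
    ⟨fun m => D2 m i j, fun m => hD2V m i j, hD2H i j⟩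
  have hHsym : ∀ i j k l, ∫ ω, H i j ω * H k l ω ∂μ = ∫ ω, H i l ω * H k j ω ∂μ := by
    intro i j k l
    refine tendsto_nhds_unique
      (hV1.cov_tendsto (fun m => hD2V m i j) (fun m => hD2V m k l) (hD2H i j) (hD2H k l)) ?_
    refine (hV1.cov_tendsto (fun m => hD2V m i l) (fun m => hD2V m k j)
      (hD2H i l) (hD2H k j)).congr fun m => ?_
    simp only [D2]
    rw [hV1.cov_diff (hAV _ _) (hAV _ _) (hAV _ _) (hAV _ _),
      hV1.cov_diff (hAV _ _) (hAV _ _) (hAV _ _) (hAV _ _)]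
    simp only [hAsym _ _ l j]
  exact hV1.seqCl.det_zero hn (GH.le_seqCl (GH.le_seqCl (hXV 0))) hHV hHsym
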